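/- arXiv:2307.07538 — 5 statements merged into one kernel-verified Lean document; each statement's English description precedes it below -/
import Mathlib

section
/- Suppose |σ_k| ≤ 1 for all k = 1, …, N and 0 < Δt ≤ Δx. Then for every matrix u ∈ ℝ^{n_x×N}: (Δt/2) · ‖ D^x u A − D^xx u |A| ‖_F² ≤ ‖ D^+ u |A|^{1/2} ‖_F², where ‖·‖_F denotes the Frobenius norm. -/
open Matrix Finset

/-- Periodic first-order central difference stencil matrix `D^x`. -/
noncomputable def Dx (nx : ℕ) [NeZero nx] (dx : ℝ) : Matrix (Fin nx) (Fin nx) ℝ :=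
  Matrix.of fun p q =>
    if q = p + 1 then 1 / (2 * dx) else if q = p - 1 then -(1 / (2 * dx)) else 0

/-- Periodic second-order stabilization stencil matrix `D^xx`. -/
noncomputable def Dxx (nx : ℕ) [NeZero nx] (dx : ℝ) : Matrix (Fin nx) (Fin nx) ℝ :=
  Matrix.of fun p q =>
    if q = p then -(1 / dx) else if q = p + 1 ∨ q = p - 1 then 1 / (2 * dx) else 0

/-- Periodic forward difference stencil matrix `D^+`. -/
noncomputable def Dplus (nx : ℕ) [NeZero nx] (dx : ℝ) : Matrix (Fin nx) (Fin nx) ℝ :=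
  Matrix.of fun p q =>
    if q = p then -(1 / Real.sqrt (2 * dx))
    else if q = p + 1 then 1 / Real.sqrt (2 * dx) else 0

lemma fin_facts (nx : ℕ) [NeZero nx] (hnx : 3 ≤ nx) (p : Fin nx) :
    p + 1 ≠ p ∧ p - 1 ≠ p ∧ p + 1 ≠ p - 1 := by
  obtain ⟨m, rfl⟩ : ∃ m, nx = m + 3 := ⟨nx - 3, by omega⟩
  have hv : ((1 : Fin (m + 3)) : ℕ) = 1 :=
    Nat.mod_eq_of_lt (show 1 < m + 3 by omega)
  have h1 : (1 : Fin (m + 3)) ≠ 0 := by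
    intro h
    have := congrArg Fin.val h
    rw [hv] at this
    simp at this
  have h2 : (1 + 1 : Fin (m + 3)) ≠ 0 := by
    intro h
    have := congrArg Fin.val h
    rw [Fin.val_add, hv, Nat.mod_eq_of_lt (by omega)] at this
    simp at this
  refine ⟨fun h => h1 ?_, fun h => h1 ?_, fun h => h2 ?_⟩
  · exact add_eq_left.mp h
  · exact sub_eq_self.mp h
  · have h3 : p + (1 + 1) = p := by
      rw [← add_assoc, h, sub_add_cancel]
    exact add_eq_left.mp h3

lemma Dx_mul (nx N : ℕ) [NeZero nx] (hnx : 3 ≤ nx) (dx : ℝ)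
    (v : Matrix (Fin nx) (Fin N) ℝ) (p : Fin nx) (k : Fin N) :
    (Dx nx dx * v) p k = 1 / (2 * dx) * (v (p + 1) k - v (p - 1) k) := by
  obtain ⟨h1, h2, h3⟩ := fin_facts nx hnx p
  have : ∀ q, Dx nx dx p q * v q k = (if q = p + 1 then 1 / (2 * dx) * v q k else 0)
      + (if q = p - 1 then -(1 / (2 * dx)) * v q k else 0) := by
    intro q
    simp only [Dx, Matrix.of_apply]
    by_cases a : q = p + 1
    · subst a; simp [h3]
    · simp [a]
  rw [Matrix.mul_apply, Finset.sum_congr rfl (fun q _ => this q), Finset.sum_add_distrib]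
  simp only [Finset.sum_ite_eq', Finset.mem_univ, if_true]
  ring

lemma Dxx_mul (nx N : ℕ) [NeZero nx] (hnx : 3 ≤ nx) (dx : ℝ)
    (v : Matrix (Fin nx) (Fin N) ℝ) (p : Fin nx) (k : Fin N) :
    (Dxx nx dx * v) p k = 1 / (2 * dx) * (v (p + 1) k + v (p - 1) k) - 1 / dx * v p k := by
  obtain ⟨h1, h2, h3⟩ := fin_facts nx hnx p
  have : ∀ q, Dxx nx dx p q * v q k = (if q = p + 1 then 1 / (2 * dx) * v q k else 0)
      + (if q = p - 1 then 1 / (2 * dx) * v q k else 0)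
      + (if q = p then -(1 / dx) * v q k else 0) := by
    intro q
    simp only [Dxx, Matrix.of_apply]
    by_cases a : q = p + 1
    · subst a; simp [h3, h1]
    · by_cases b : q = p
      · subst b; simp [h1.symm, h2.symm]
      · simp [a, b]
  rw [Matrix.mul_apply, Finset.sum_congr rfl (fun q _ => this q), Finset.sum_add_distrib,
    Finset.sum_add_distrib]
  simp only [Finset.sum_ite_eq', Finset.mem_univ, if_true]
  ring

lemma Dplus_mul (nx N : ℕ) [NeZero nx] (hnx : 3 ≤ nx) (dx : ℝ)
    (v : Matrix (Fin nx) (Fin N) ℝ) (p : Fin nx) (k : Fin N) :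
    (Dplus nx dx * v) p k = 1 / Real.sqrt (2 * dx) * (v (p + 1) k - v p k) := by
  obtain ⟨h1, h2, h3⟩ := fin_facts nx hnx p
  have : ∀ q, Dplus nx dx p q * v q k = (if q = p + 1 then 1 / Real.sqrt (2 * dx) * v q k else 0)
      + (if q = p then -(1 / Real.sqrt (2 * dx)) * v q k else 0) := by
    intro q
    simp only [Dplus, Matrix.of_apply]
    by_cases a : q = p
    · subst a; simp [h1.symm]
    · simp [a]
  rw [Matrix.mul_apply, Finset.sum_congr rfl (fun q _ => this q), Finset.sum_add_distrib]
  simp only [Finset.sum_ite_eq', Finset.mem_univ, if_true]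
  ring

lemma frob_inv (n N : ℕ) (Q : Matrix (Fin N) (Fin N) ℝ) (hQ : Qᵀ * Q = 1)
    (M : Matrix (Fin n) (Fin N) ℝ) :
    ∑ p, ∑ k, ((M * Qᵀ) p k) ^ 2 = ∑ p, ∑ k, (M p k) ^ 2 := by
  have key : ∀ (L : Matrix (Fin n) (Fin N) ℝ) p, ∑ k, (L p k) ^ 2 = (L * Lᵀ) p p := by
    intro L p
    simp [Matrix.mul_apply, sq]
  refine Finset.sum_congr rfl fun p _ => ?_
  rw [key, key, Matrix.transpose_mul, Matrix.transpose_transpose, Matrix.mul_assoc,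
    ← Matrix.mul_assoc Qᵀ, hQ, Matrix.one_mul]

lemma col_ineq (nx : ℕ) [NeZero nx] (dx dt : ℝ) (hdx : 0 < dx) (hdt : 0 < dt)
    (hdtdx : dt ≤ dx) (s : ℝ) (hs : |s| ≤ 1) (w : Fin nx → ℝ) :
    dt / 2 * ∑ p, (1 / (2 * dx) * (w (p + 1) - w (p - 1)) * s -
      (1 / (2 * dx) * (w (p + 1) + w (p - 1)) - 1 / dx * w p) * |s|) ^ 2 ≤
    ∑ p, (1 / Real.sqrt (2 * dx) * (w (p + 1) - w p) * Real.sqrt |s|) ^ 2 := by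
  have hR : ∑ p, (1 / Real.sqrt (2 * dx) * (w (p + 1) - w p) * Real.sqrt |s|) ^ 2
      = |s| / (2 * dx) * ∑ p, (w (p + 1) - w p) ^ 2 := by
    rw [Finset.mul_sum]
    refine Finset.sum_congr rfl fun p _ => ?_
    rw [mul_pow, mul_pow, div_pow, Real.sq_sqrt (by positivity), Real.sq_sqrt (abs_nonneg s)]
    ring
  have hshift : ∑ p, (w p - w (p - 1)) ^ 2 = ∑ p, (w (p + 1) - w p) ^ 2 := by
    rw [← Equiv.sum_comp (Equiv.addRight (1 : Fin nx))]
    simp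
  have hL : ∑ p, (1 / (2 * dx) * (w (p + 1) - w (p - 1)) * s -
      (1 / (2 * dx) * (w (p + 1) + w (p - 1)) - 1 / dx * w p) * |s|) ^ 2
      = |s| ^ 2 / dx ^ 2 * ∑ p, (w (p + 1) - w p) ^ 2 := by
    rcases abs_cases s with ⟨h, _⟩ | ⟨h, _⟩
    · rw [← hshift, Finset.mul_sum, h]
      refine Finset.sum_congr rfl fun p _ => ?_
      field_simp
      ring
    · rw [Finset.mul_sum, h]
      refine Finset.sum_congr rfl fun p _ => ?_
      field_simp
      ring
  rw [hL, hR, ← mul_assoc]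
  refine mul_le_mul_of_nonneg_right ?_ (Finset.sum_nonneg fun p _ => sq_nonneg _)
  have h0 := abs_nonneg s
  rw [show dt / 2 * (|s| ^ 2 / dx ^ 2) = (dt * |s|) * (|s| / (2 * dx ^ 2)) by ring,
    show |s| / (2 * dx) = dx * (|s| / (2 * dx ^ 2)) by field_simp]
  refine mul_le_mul_of_nonneg_right ?_ (by positivity)
  nlinarith

/-- Lemma 2 of the paper: if `|σ_k| ≤ 1` for all `k` and `0 < Δt ≤ Δx`, then for every
`u ∈ ℝ^{n_x×N}` one has
`(Δt/2)·‖D^x u A − D^xx u |A|‖_F² ≤ ‖D^+ u |A|^{1/2}‖_F²`,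
where `A = Q diag(σ) Qᵀ`, `|A| = Q diag(|σ|) Qᵀ` and `|A|^{1/2} = Q diag(|σ|^{1/2}) Qᵀ`. -/
theorem cfl_frobenius_inequality (nx N : ℕ) [NeZero nx] [NeZero N] (hnx : 3 ≤ nx)
    (dx dt : ℝ) (hdx : 0 < dx) (hdt : 0 < dt) (hdtdx : dt ≤ dx)
    (Q : Matrix (Fin N) (Fin N) ℝ) (hQ : Qᵀ * Q = 1) (hQ' : Q * Qᵀ = 1)
    (σs : Fin N → ℝ) (hσs : ∀ k, |σs k| ≤ 1)
    (u : Matrix (Fin nx) (Fin N) ℝ) :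
    dt / 2 * ∑ p, ∑ k,
        ((Dx nx dx * u * (Q * Matrix.diagonal σs * Qᵀ) -
          Dxx nx dx * u * (Q * Matrix.diagonal (fun i => |σs i|) * Qᵀ)) p k) ^ 2 ≤
      ∑ p, ∑ k,
        ((Dplus nx dx * u * (Q * Matrix.diagonal (fun i => Real.sqrt |σs i|) * Qᵀ)) p k) ^ 2 := by
  have e1 : Dx nx dx * u * (Q * Matrix.diagonal σs * Qᵀ) -
      Dxx nx dx * u * (Q * Matrix.diagonal (fun i => |σs i|) * Qᵀ)
      = (Dx nx dx * (u * Q) * Matrix.diagonal σs -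
        Dxx nx dx * (u * Q) * Matrix.diagonal (fun i => |σs i|)) * Qᵀ := by
    simp only [Matrix.sub_mul, Matrix.mul_assoc]
  have e2 : Dplus nx dx * u * (Q * Matrix.diagonal (fun i => Real.sqrt |σs i|) * Qᵀ)
      = (Dplus nx dx * (u * Q) * Matrix.diagonal (fun i => Real.sqrt |σs i|)) * Qᵀ := by
    simp only [Matrix.mul_assoc]
  rw [e1, e2, frob_inv _ _ _ hQ, frob_inv _ _ _ hQ, Finset.sum_comm, Finset.mul_sum,
    Finset.sum_comm (f := fun p k => ((Dplus nx dx * (u * Q) *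
      Matrix.diagonal (fun i => Real.sqrt |σs i|)) p k) ^ 2)]
  refine Finset.sum_le_sum fun k _ => ?_
  simp only [Matrix.sub_apply, Matrix.mul_diagonal, Dx_mul nx N hnx, Dxx_mul nx N hnx,
    Dplus_mul nx N hnx]
  exact col_ineq nx dx dt hdx hdt hdtdx (σs k) (hσs k) (fun p => (u * Q) p k)
end

section
/- Let σ ≥ 0. Let P^X ∈ ℝ^{n_x×n_x} and P^V ∈ ℝ^{N×N} be orthogonal projection matrices (symmetric and idempotent). Let u : ℝ → ℝ^{n_x×N} and B : ℝ → ℝ^{n_x} be differentiable and satisfy, for all t: P^X u(t) = u(t), u(t) P^V = u(t), u′(t) = − P^X D^x u(t) A P^V + P^X D^xx u(t) |A| P^V + σ·( P^X B(t) e₁ᵀ P^V − u(t) ), and B′(t) = σ·( u(t) e₁ − B(t) ), where e₁ ∈ ℝ^{N} is the first standard basis vector. Then the total energy E(t) := (1/2)‖u(t)‖_F² + (1/2)‖B(t)‖² satisfies the exact dissipation identity E′(t) = − ‖ D^+ u(t) |A|^{1/2} ‖_F² − σ·( ‖u(t) e₁ − B(t)‖² + Σ_{m ≠ 1} ‖u(t)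 e_m‖² ). -/
open Matrix Finset

/-- The first standard basis vector `e₁ ∈ ℝ^N` (zeroth angular moment). -/
def e1 (N : ℕ) [NeZero N] : Fin N → ℝ := fun m => if m = 0 then 1 else 0

theorem fin_one_ne (nx : ℕ) [NeZero nx] (hnx : 3 ≤ nx) : (1 : Fin nx) ≠ 0 := by
  obtain ⟨n, rfl⟩ := Nat.exists_eq_add_of_le' hnx
  intro h
  have := congrArg Fin.val h
  simp [Fin.val_one'] at this

theorem fin_two_ne (nx : ℕ) [NeZero nx] (hnx : 3 ≤ nx) : (1 + 1 : Fin nx) ≠ 0 := by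
  obtain ⟨n, rfl⟩ := Nat.exists_eq_add_of_le' hnx
  intro h
  have := congrArg Fin.val h
  rw [Fin.val_add, Fin.val_one', Nat.mod_eq_of_lt (by omega : 1 < n + 3),
    Nat.mod_eq_of_lt (by omega : 1 + 1 < n + 3)] at this
  simp at this

theorem Dx_transpose (nx : ℕ) [NeZero nx] (hnx : 3 ≤ nx) (dx : ℝ) :
    (Dx nx dx)ᵀ = -Dx nx dx := by
  have h2 := fin_two_ne nx hnx
  ext p q
  simp only [Dx, transpose_apply, of_apply, Matrix.neg_apply]
  have e1 : (p = q + 1) ↔ (q = p - 1) := by rw [eq_sub_iff_add_eq, eq_comm]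
  have e2 : (p = q - 1) ↔ (q = p + 1) := by rw [eq_sub_iff_add_eq, eq_comm]
  have e3 : q = p - 1 → q = p + 1 → False := by
    intro a b
    rw [eq_sub_iff_add_eq, b, add_assoc] at a
    exact h2 (by simpa using a)
  simp only [e1, e2]
  by_cases a : q = p - 1 <;> by_cases b : q = p + 1
  · exact (e3 a b).elim
  · simp only [if_pos a, if_neg b, neg_neg]
  · simp only [if_neg a, if_pos b]
  · simp only [if_neg a, if_neg b, neg_zero]

theorem Dplus_eq (nx : ℕ) [NeZero nx] (hnx : 3 ≤ nx) (dx : ℝ) (p q : Fin nx) :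
    Dplus nx dx p q = (1 / Real.sqrt (2 * dx)) *
      ((if q = p + 1 then 1 else 0) - (if q = p then 1 else 0)) := by
  have h1 := fin_one_ne nx hnx
  simp only [Dplus, of_apply]
  by_cases a : q = p
  · subst a
    simp [h1]
  · simp [a]

theorem Dxx_eq (nx : ℕ) [NeZero nx] (hnx : 3 ≤ nx) (dx : ℝ) (hdx : 0 < dx) :
    Dxx nx dx = -((Dplus nx dx)ᵀ * Dplus nx dx) := by
  have h1 := fin_one_ne nx hnx
  have h2 := fin_two_ne nx hnx
  ext p q
  have hc : (1 / Real.sqrt (2 * dx)) * (1 / Real.sqrt (2 * dx)) = 1 / (2 * dx) := by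
    rw [div_mul_div_comm, Real.mul_self_sqrt (by positivity), one_mul]
  have key : ((Dplus nx dx)ᵀ * Dplus nx dx) p q = (1 / (2 * dx)) *
      ((if q = p then 1 else 0) - (if q = p - 1 then 1 else 0)
        - (if q = p + 1 then 1 else 0) + (if q = p then 1 else 0)) := by
    rw [mul_apply]
    have : ∀ k, (Dplus nx dx)ᵀ p k * Dplus nx dx k q = (1 / (2 * dx)) *
      ((if k = p - 1 then (if q = k + 1 then 1 else 0) else 0)
        - (if k = p - 1 then (if q = k then 1 else 0) else 0)
        - (if k = p then (if q = k + 1 then 1 else 0) else 0)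
        + (if k = p then (if q = k then 1 else 0) else 0)) := by
      intro k
      rw [transpose_apply, Dplus_eq nx hnx, Dplus_eq nx hnx, ← hc]
      have e1 : (p = k + 1) ↔ (k = p - 1) := by rw [eq_sub_iff_add_eq, eq_comm]
      have e2 : (p = k) ↔ (k = p) := eq_comm
      simp only [e1, e2]
      by_cases a : k = p - 1
      · by_cases b : k = p
        · simp only [if_pos a, if_pos b]
          ring
        · simp only [if_pos a, if_neg b]
          ring
      · by_cases b : k = p
        · simp only [if_neg a, if_pos b]
          ring
        · simp only [if_neg a, if_neg b]
          ring
    simp only [this, ← Finset.mul_sum, Finset.sum_add_distrib, Finset.sum_sub_distrib,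
      Finset.sum_ite_eq', Finset.mem_univ, if_true, sub_add_cancel]
  rw [Matrix.neg_apply, key]
  simp only [Dxx, of_apply]
  have e3 : q = p - 1 → q = p + 1 → False := by
    intro a b
    rw [eq_sub_iff_add_eq, b, add_assoc] at a
    exact h2 (by simpa using a)
  have e4 : q = p - 1 → q = p → False := by
    intro a b
    rw [eq_sub_iff_add_eq, b] at a
    exact h1 (by simpa using a)
  have e5 : q = p + 1 → q = p → False := by
    intro a b
    rw [b] at a
    exact h1 (by simpa using a.symm)
  by_cases a : q = p
  · have b : ¬ q = p - 1 := fun h => e4 h a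
    have c : ¬ q = p + 1 := fun h => e5 h a
    simp only [if_pos a, if_neg b, if_neg c]
    field_simp
    ring
  · by_cases b : q = p - 1
    · have c : ¬ q = p + 1 := fun h => e3 b h
      simp only [if_neg a, if_pos b, if_neg c, if_pos (Or.inr b : q = p + 1 ∨ q = p - 1)]
      ring
    · by_cases c : q = p + 1
      · simp only [if_neg a, if_neg b, if_pos c, if_pos (Or.inl c : q = p + 1 ∨ q = p - 1)]
        ring
      · have d : ¬ (q = p + 1 ∨ q = p - 1) := by tauto
        simp only [if_neg a, if_neg b, if_neg c, if_neg d]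
        ring

theorem sum_eq_trace {m n : ℕ} (X Y : Matrix (Fin m) (Fin n) ℝ) :
    ∑ j, ∑ k, X j k * Y j k = trace (Xᵀ * Y) := by
  rw [Finset.sum_comm]
  simp [trace, mul_apply]

theorem trace_proj {m n : ℕ} (PX : Matrix (Fin m) (Fin m) ℝ) (PV : Matrix (Fin n) (Fin n) ℝ)
    (hX : PXᵀ = PX) (hV : PVᵀ = PV) (U Z : Matrix (Fin m) (Fin n) ℝ)
    (h1 : PX * U = U) (h2 : U * PV = U) :
    trace (Uᵀ * (PX * Z * PV)) = trace (Uᵀ * Z) := by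
  have a : Uᵀ * PX = Uᵀ := by
    conv_rhs => rw [← h1, transpose_mul, hX]
  have b : PV * Uᵀ = Uᵀ := by
    conv_rhs => rw [← h2, transpose_mul, hV]
  rw [← Matrix.mul_assoc, trace_mul_comm, ← Matrix.mul_assoc Uᵀ, a, ← Matrix.mul_assoc, b]

theorem trace_adv {m n : ℕ} (D : Matrix (Fin m) (Fin m) ℝ) (A : Matrix (Fin n) (Fin n) ℝ)
    (hD : Dᵀ = -D) (hA : Aᵀ = A) (U : Matrix (Fin m) (Fin n) ℝ) :
    trace (Uᵀ * (D * U * A)) = 0 := by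
  have h : trace (Uᵀ * (D * U * A)) = - trace (Uᵀ * (D * U * A)) := by
    conv_lhs => rw [← trace_transpose]
    simp only [transpose_mul, transpose_transpose, hA, hD]
    rw [Matrix.mul_assoc, trace_mul_comm]
    simp [Matrix.mul_assoc]
  linarith

theorem trace_diss {m n : ℕ} (D : Matrix (Fin m) (Fin m) ℝ) (A : Matrix (Fin n) (Fin n) ℝ)
    (hA : Aᵀ = A) (U : Matrix (Fin m) (Fin n) ℝ) :
    trace (Uᵀ * (-(Dᵀ * D) * U * (A * A))) = -trace ((D * U * A)ᵀ * (D * U * A)) := by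
  simp only [transpose_mul, hA]
  rw [Matrix.mul_assoc A, trace_mul_comm A]
  simp [Matrix.mul_assoc]

/-- Exact energy dissipation identity for the semi-discrete projected Galerkin system of
the Su-Olson problem: along solutions of
`u′ = −P^X D^x u A P^V + P^X D^xx u |A| P^V + σ(P^X B e₁ᵀ P^V − u)`,
`B′ = σ(u e₁ − B)`, the total energy `E = ½‖u‖_F² + ½‖B‖²` satisfies
`E′(t) = −‖D^+ u |A|^{1/2}‖_F² − σ(‖u e₁ − B‖² + Σ_{m≠1} ‖u e_m‖²)`. -/
theorem semidiscrete_energy_dissipation_identity (nx N : ℕ) [NeZero nx] [NeZero N]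
    (hnx : 3 ≤ nx) (dx : ℝ) (hdx : 0 < dx)
    (Q : Matrix (Fin N) (Fin N) ℝ) (hQ : Qᵀ * Q = 1) (hQ' : Q * Qᵀ = 1)
    (σs : Fin N → ℝ) (σ : ℝ) (hσ : 0 ≤ σ)
    (PX : Matrix (Fin nx) (Fin nx) ℝ) (hPXsymm : PXᵀ = PX) (hPXidem : PX * PX = PX)
    (PV : Matrix (Fin N) (Fin N) ℝ) (hPVsymm : PVᵀ = PV) (hPVidem : PV * PV = PV)
    (u : ℝ → Matrix (Fin nx) (Fin N) ℝ) (B : ℝ → Fin nx → ℝ)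
    (hproju1 : ∀ t, PX * u t = u t) (hproju2 : ∀ t, u t * PV = u t)
    (hu : ∀ t j k, HasDerivAt (fun s => u s j k)
      ((-(PX * Dx nx dx * u t * (Q * Matrix.diagonal σs * Qᵀ) * PV)
        + PX * Dxx nx dx * u t * (Q * Matrix.diagonal (fun i => |σs i|) * Qᵀ) * PV
        + σ • (PX * Matrix.vecMulVec (B t) (e1 N) * PV - u t)) j k) t)
    (hB : ∀ t j, HasDerivAt (fun s => B s j)
      (σ * ((u t).mulVec (e1 N) j - B t j)) t) :
    ∀ t, HasDerivAt
      (fun s => (1 / 2) * ∑ j, ∑ m, (u s j m) ^ 2 + (1 / 2) * ∑ j, (B s j) ^ 2)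
      (-(∑ j, ∑ m,
          ((Dplus nx dx * u t * (Q * Matrix.diagonal (fun i => Real.sqrt |σs i|) * Qᵀ)) j m) ^ 2)
        - σ * ((∑ j, ((u t).mulVec (e1 N) j - B t j) ^ 2)
            + ∑ m ∈ Finset.univ.erase (0 : Fin N), ∑ j, (u t j m) ^ 2)) t := by
  intro t
  have hder : HasDerivAt
      (fun s => (1 / 2) * ∑ j, ∑ m, (u s j m) ^ 2 + (1 / 2) * ∑ j, (B s j) ^ 2)
      ((1 / 2) * ∑ j, ∑ m, (2 : ℕ) * (u t j m) ^ (2 - 1) *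
        ((-(PX * Dx nx dx * u t * (Q * Matrix.diagonal σs * Qᵀ) * PV)
        + PX * Dxx nx dx * u t * (Q * Matrix.diagonal (fun i => |σs i|) * Qᵀ) * PV
        + σ • (PX * Matrix.vecMulVec (B t) (e1 N) * PV - u t)) j m)
        + (1 / 2) * ∑ j, (2 : ℕ) * (B t j) ^ (2 - 1) *
          (σ * ((u t).mulVec (e1 N) j - B t j))) t := by
    refine HasDerivAt.add ?_ ?_
    · refine HasDerivAt.const_mul _ ?_
      refine HasDerivAt.fun_sum fun j _ => HasDerivAt.fun_sum fun m _ => ?_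
      exact (hu t j m).fun_pow 2
    · refine HasDerivAt.const_mul _ ?_
      refine HasDerivAt.fun_sum fun j _ => ?_
      exact (hB t j).fun_pow 2
  convert hder using 1
  have hs1 := hproju1 t
  have hs2 := hproju2 t
  generalize u t = U at *
  generalize B t = b at *
  have hsymm : ∀ d : Fin N → ℝ, (Q * Matrix.diagonal d * Qᵀ)ᵀ = Q * Matrix.diagonal d * Qᵀ := by
    intro d
    simp [transpose_mul, Matrix.mul_assoc]
  have hsq : Q * Matrix.diagonal (fun i => |σs i|) * Qᵀ
      = (Q * Matrix.diagonal (fun i => Real.sqrt |σs i|) * Qᵀ)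
        * (Q * Matrix.diagonal (fun i => Real.sqrt |σs i|) * Qᵀ) := by
    have : Matrix.diagonal (fun i => |σs i|) = Matrix.diagonal (fun i => Real.sqrt |σs i|)
        * Matrix.diagonal (fun i => Real.sqrt |σs i|) := by
      rw [diagonal_mul_diagonal]
      congr 1
      funext i
      rw [Real.mul_self_sqrt (abs_nonneg _)]
    rw [this]
    generalize Matrix.diagonal (fun i => Real.sqrt |σs i|) = S
    calc Q * (S * S) * Qᵀ = Q * S * 1 * (S * Qᵀ) := by simp [Matrix.mul_assoc]
      _ = _ := by rw [← hQ]; simp only [Matrix.mul_assoc]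
  have hmain : ∑ j, ∑ m, U j m *
        ((-(PX * Dx nx dx * U * (Q * Matrix.diagonal σs * Qᵀ) * PV)
        + PX * Dxx nx dx * U * (Q * Matrix.diagonal (fun i => |σs i|) * Qᵀ) * PV
        + σ • (PX * Matrix.vecMulVec b (e1 N) * PV - U)) j m)
      = -(∑ j, ∑ m,
          ((Dplus nx dx * U * (Q * Matrix.diagonal (fun i => Real.sqrt |σs i|) * Qᵀ)) j m) ^ 2)
        + σ * (∑ j, U j 0 * b j - ∑ j, ∑ m, U j m ^ 2) := by
    have r1 : PX * Dx nx dx * U * (Q * Matrix.diagonal σs * Qᵀ) * PV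
        = PX * (Dx nx dx * U * (Q * Matrix.diagonal σs * Qᵀ)) * PV := by
      simp only [Matrix.mul_assoc]
    have r2 : ∀ A : Matrix (Fin N) (Fin N) ℝ, PX * Dxx nx dx * U * A * PV
        = PX * (Dxx nx dx * U * A) * PV := by
      intro A
      simp only [Matrix.mul_assoc]
    have r3 : ∑ j, U j 0 * b j = trace (Uᵀ * Matrix.vecMulVec b (e1 N)) := by
      rw [← sum_eq_trace]
      simp [vecMulVec_apply, e1]
    simp only [pow_two]
    rw [sum_eq_trace, sum_eq_trace, sum_eq_trace, r1, r2, r3, Matrix.mul_add, Matrix.mul_add,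
      Matrix.mul_neg, Matrix.mul_smul, Matrix.mul_sub, trace_add, trace_add, trace_neg, trace_smul,
      trace_sub, trace_proj PX PV hPXsymm hPVsymm U _ hs1 hs2,
      trace_proj PX PV hPXsymm hPVsymm U _ hs1 hs2,
      trace_proj PX PV hPXsymm hPVsymm U _ hs1 hs2,
      trace_adv _ _ (Dx_transpose nx hnx dx) (hsymm _), Dxx_eq nx hnx dx hdx, hsq,
      trace_diss _ _ (hsymm _), smul_eq_mul]
    ring
  have hue : ∀ j, U.mulVec (e1 N) j = U j 0 := by
    intro j
    simp [mulVec, dotProduct, e1]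
  have hfac : ∀ x y : ℝ, ((2 : ℕ) : ℝ) * x ^ (2 - 1) * y = 2 * (x * y) := by
    intro x y
    norm_num
    ring
  have hsplit : ∑ j, ∑ m, U j m ^ 2 = ∑ j, U j 0 ^ 2
      + ∑ m ∈ Finset.univ.erase (0 : Fin N), ∑ j, U j m ^ 2 := by
    rw [Finset.sum_comm, Finset.add_sum_erase _ (fun m => ∑ j, U j m ^ 2) (Finset.mem_univ 0)]
  simp only [hfac, ← Finset.mul_sum]
  rw [hmain, hsplit]
  simp only [hue]
  have hexpA : ∑ j, (U j 0 - b j) ^ 2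
      = ∑ j, U j 0 ^ 2 - 2 * ∑ j, U j 0 * b j + ∑ j, b j ^ 2 := by
    rw [Finset.mul_sum, ← Finset.sum_sub_distrib, ← Finset.sum_add_distrib]
    exact Finset.sum_congr rfl fun j _ => by ring
  have hexpB : ∑ j, b j * (σ * (U j 0 - b j)) = σ * (∑ j, U j 0 * b j - ∑ j, b j ^ 2) := by
    rw [← Finset.sum_sub_distrib, Finset.mul_sum]
    exact Finset.sum_congr rfl fun j _ => by ring
  rw [hexpA, hexpB]
  ring
end

section
/- Let σ > 0, Δt > 0 and u¹ > 0, and let α be any real number with 0 < α < σΔt·u¹ / (1 + σΔt + σ²Δt² + (1/2)σ³Δt³). Define B¹ := u¹ + α, B⁰ := u¹ + α(1 + σΔt) and u⁰ := u¹ − σΔt·α·(1 + σΔt). Then: (i) u¹ = u⁰ + σΔt·(B⁰ − u¹) (i.e., (u⁰, B⁰) is mapped to u¹ by one step of the naive IMEX update with B treated explicitly); (ii) B¹ = B⁰ + σΔt·(u¹ − B¹); and (iii) the total energy strictly increases: (1/2)(u¹)² + (1/2)(B¹)² > (1/2)(u⁰)² + (1/2)(B⁰)². -/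
/-- Scalar core of the instability of the naive IMEX scheme (Theorem 2 of the paper):
with `B¹ = u¹ + α`, `B⁰ = u¹ + α(1 + σΔt)` and `u⁰ = u¹ − σΔt·α·(1 + σΔt)`, one step of
the naive IMEX update maps `(u⁰, B⁰)` to `(u¹, B¹)` and the total energy strictly
increases. -/
theorem naive_imex_scalar_energy_increase (σ dt u1 α : ℝ)
    (hσ : 0 < σ) (hdt : 0 < dt) (hu1 : 0 < u1) (hα0 : 0 < α)
    (hα : α < σ * dt * u1 /
      (1 + σ * dt + σ ^ 2 * dt ^ 2 + (1 / 2) * σ ^ 3 * dt ^ 3)) :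
    u1 = (u1 - σ * dt * α * (1 + σ * dt)) +
        σ * dt * ((u1 + α * (1 + σ * dt)) - u1) ∧
      (u1 + α) = (u1 + α * (1 + σ * dt)) + σ * dt * (u1 - (u1 + α)) ∧
      (1 / 2) * u1 ^ 2 + (1 / 2) * (u1 + α) ^ 2 >
        (1 / 2) * (u1 - σ * dt * α * (1 + σ * dt)) ^ 2 +
          (1 / 2) * (u1 + α * (1 + σ * dt)) ^ 2 := by
  have hD : 0 < 1 + σ * dt + σ ^ 2 * dt ^ 2 + (1 / 2) * σ ^ 3 * dt ^ 3 := by positivity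
  rw [lt_div_iff₀ hD] at hα
  refine ⟨by ring, by ring, ?_⟩
  have hs : 0 < α * (σ * dt) := by positivity
  have h := mul_pos hs (sub_pos.mpr hα)
  linarith
end

section
/- For every integer n_x ≥ 3, every N ≥ 1, every Δx > 0, every σ > 0, every Δt > 0 and every symmetric A ∈ ℝ^{N×N} with spectral decomposition as below, there exist matrices u⁰, u¹ ∈ ℝ^{n_x×N} and vectors B⁰, B¹ ∈ ℝ^{n_x} satisfying the naive IMEX update u¹ = u⁰ − Δt·D^x u⁰ A + Δt·D^xx u⁰ |A| + σΔt·( B⁰ e₁ᵀ − u¹ ) and B¹ = B⁰ + σΔt·( u¹ e₁ − B¹ ), where e₁ ∈ ℝ^{N} is the first standard basis vector, such that the total energy strictly increases: (1/2)‖u¹‖_F² + (1/2)‖B¹‖² > (1/2)‖u⁰‖_F² + (1/2)‖B⁰‖². -/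
open Matrix Finset

lemma fin_ne_aux (nx : ℕ) [NeZero nx] (hnx : 3 ≤ nx) (p : Fin nx) :
    p + 1 ≠ p - 1 ∧ p ≠ p + 1 ∧ p ≠ p - 1 := by
  have h1 : (1 : Fin nx).val = 1 := by
    rw [Fin.val_one']; exact Nat.mod_eq_of_lt (by omega)
  have hp := p.isLt
  have ha : (p + 1).val = if p.val + 1 = nx then 0 else p.val + 1 := by
    rw [Fin.val_add, h1]
    split_ifs with h
    · rw [h, Nat.mod_self]
    · exact Nat.mod_eq_of_lt (by omega)
  have hb : (p - 1).val = if p.val = 0 then nx - 1 else p.val - 1 := by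
    rw [Fin.val_sub, h1]
    split_ifs with h
    · rw [h]; exact Nat.mod_eq_of_lt (by omega)
    · have : nx - 1 + p.val = (p.val - 1) + nx := by omega
      rw [this, Nat.add_mod_right]; exact Nat.mod_eq_of_lt (by omega)
  refine ⟨fun h => ?_, fun h => ?_, fun h => ?_⟩ <;>
  · have := congrArg Fin.val h
    simp only [ha, hb] at this
    split_ifs at this <;> omega

lemma Dx_row (nx : ℕ) [NeZero nx] (hnx : 3 ≤ nx) (dx : ℝ) (p : Fin nx) :
    ∑ q, Dx nx dx p q = 0 := by
  obtain ⟨h1, h2, h3⟩ := fin_ne_aux nx hnx p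
  have : ∀ q, Dx nx dx p q = (if q = p + 1 then 1 / (2 * dx) else 0)
      + (if q = p - 1 then -(1 / (2 * dx)) else 0) := by
    intro q
    simp only [Dx, Matrix.of_apply]
    by_cases ha : q = p + 1
    · subst ha; rw [if_pos rfl, if_pos rfl, if_neg h1, add_zero]
    · rw [if_neg ha, if_neg ha, zero_add]
  simp [this, Finset.sum_add_distrib]

lemma Dxx_row (nx : ℕ) [NeZero nx] (hnx : 3 ≤ nx) (dx : ℝ) (p : Fin nx) :
    ∑ q, Dxx nx dx p q = 0 := by
  obtain ⟨h1, h2, h3⟩ := fin_ne_aux nx hnx p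
  have : ∀ q, Dxx nx dx p q = (if q = p then -(1 / dx) else 0)
      + (if q = p + 1 then 1 / (2 * dx) else 0)
      + (if q = p - 1 then 1 / (2 * dx) else 0) := by
    intro q
    simp only [Dxx, Matrix.of_apply]
    by_cases h0 : q = p
    · subst h0; simp [h2, h3]
    · by_cases ha : q = p + 1
      · subst ha; simp [h1, h0]
      · simp [h0, ha]
  simp only [this, Finset.sum_add_distrib, Finset.sum_ite_eq', Finset.mem_univ, if_true]
  rw [one_div, one_div, mul_inv]; ring

lemma mul_const_zero {nx N : ℕ} (D : Matrix (Fin nx) (Fin nx) ℝ)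
    (hD : ∀ p, ∑ q, D p q = 0) (v : Fin N → ℝ) :
    D * (Matrix.of fun _ m => v m : Matrix (Fin nx) (Fin N) ℝ) = 0 := by
  ext p m
  simp [Matrix.mul_apply, ← Finset.sum_mul, hD]

/-- Theorem 2 of the paper: the naive IMEX time discretization of the Su-Olson system can
increase the total energy. For every `n_x ≥ 3`, `N ≥ 1`, `Δx > 0`, `σ > 0`, `Δt > 0` and
symmetric `A = Q diag(σ₁,…,σ_N) Qᵀ` there exist data `(u⁰, B⁰)` mapped by one naive IMEX
step to `(u¹, B¹)` such that `½‖u¹‖_F² + ½‖B¹‖² > ½‖u⁰‖_F² + ½‖B⁰‖²`. -/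
theorem naive_imex_energy_increase (nx N : ℕ) [NeZero nx] [NeZero N] (hnx : 3 ≤ nx)
    (dx : ℝ) (hdx : 0 < dx) (σ dt : ℝ) (hσ : 0 < σ) (hdt : 0 < dt)
    (Q : Matrix (Fin N) (Fin N) ℝ) (hQ : Qᵀ * Q = 1) (hQ' : Q * Qᵀ = 1)
    (σs : Fin N → ℝ) :
    ∃ (u0 u1 : Matrix (Fin nx) (Fin N) ℝ) (B0 B1 : Fin nx → ℝ),
      u1 = u0 - dt • (Dx nx dx * u0 * (Q * Matrix.diagonal σs * Qᵀ))
          + dt • (Dxx nx dx * u0 * (Q * Matrix.diagonal (fun i => |σs i|) * Qᵀ))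
          + (σ * dt) • (Matrix.vecMulVec B0 (e1 N) - u1) ∧
      B1 = B0 + (σ * dt) • (u1.mulVec (e1 N) - B1) ∧
      (1 / 2) * ∑ j, ∑ m, (u1 j m) ^ 2 + (1 / 2) * ∑ j, (B1 j) ^ 2 >
        (1 / 2) * ∑ j, ∑ m, (u0 j m) ^ 2 + (1 / 2) * ∑ j, (B0 j) ^ 2 := by
  set s := σ * dt with hs
  have hs0 : 0 < s := mul_pos hσ hdt
  have hs1 : (1 + s) ≠ 0 := by positivity
  obtain ⟨d, hd⟩ : ∃ d, d = s ^ 2 / (1 + s) ^ 2 := ⟨_, rfl⟩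
  have hd0 : 0 < d := by rw [hd]; positivity
  obtain ⟨a, ha⟩ : ∃ a, a = 1 + s * d / (1 + s) := ⟨_, rfl⟩
  obtain ⟨b, hb⟩ : ∃ b, b = 1 + (1 + s + s ^ 2) * d / (1 + s) ^ 2 := ⟨_, rfl⟩
  have ea : a = 1 + s * ((1 + d) - a) := by rw [ha]; field_simp; ring
  have eb : b = (1 + d) + s * (a - b) := by rw [ha, hb]; field_simp; ring
  have hlin : s * d / (1 + s) + (1 + s + s ^ 2) * d / (1 + s) ^ 2 = d + d ^ 2 := by
    have : d ^ 2 = d * (s ^ 2 / (1 + s) ^ 2) := by rw [← hd]; ring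
    rw [this]; field_simp; ring
  have key : 1 ^ 2 + (1 + d) ^ 2 < a ^ 2 + b ^ 2 := by
    have h1 : 0 < s * d / (1 + s) := by positivity
    have h2 : 0 < (1 + s + s ^ 2) * d / (1 + s) ^ 2 := by positivity
    rw [ha, hb]
    nlinarith [sq_nonneg d, mul_pos h1 h1, mul_pos h2 h2]
  refine ⟨Matrix.of fun _ m => e1 N m, Matrix.of fun _ m => a * e1 N m,
    fun _ => 1 + d, fun _ => b, ?_, ?_, ?_⟩
  · rw [mul_const_zero _ (Dx_row nx hnx dx), mul_const_zero _ (Dxx_row nx hnx dx)]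
    ext p m
    simp only [Matrix.zero_mul, smul_zero, sub_zero, add_zero, Matrix.add_apply,
      Matrix.smul_apply, Matrix.sub_apply, Matrix.of_apply, Matrix.vecMulVec_apply, smul_eq_mul]
    linear_combination (e1 N m) * ea
  · ext p
    simp [Matrix.mulVec, dotProduct, e1]
    linarith
  · have hn : (0 : ℝ) < nx := by exact_mod_cast (by omega : 0 < nx)
    simp [e1]
    nlinarith [mul_lt_mul_of_pos_left key hn]
end

section
/- Assume |σ_k| ≤ 1 for all k, 0 < Δt ≤ Δx, and σ ≥ 0. Let P^X ∈ ℝ^{n_x×n_x} and P^V ∈ ℝ^{N×N} be orthogonal projection matrices (symmetric and idempotent) with P^V e₁ = e₁, where e₁ ∈ ℝ^{N} is the first standard basis vector. Let u⁰ ∈ ℝ^{n_x×N} satisfy P^X u⁰ = u⁰ and u⁰ P^V = u⁰, and let B⁰ ∈ ℝ^{n_x}. Define u* := u⁰ − Δt·P^X D^x u⁰ A P^V + Δt·P^X D^xx u⁰ |A| P^V. Let û₀, B¹ ∈ ℝ^{n_x} satisfy the coupled implicit equations û₀ = u⁰ e₁ − Δt·D^x u⁰ A e₁ + Δt·D^xx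 u⁰ |A| e₁ + σΔt·(B¹ − û₀) and B¹ = B⁰ + σΔt·(û₀ − B¹), and assume P^X û₀ = û₀. Define u¹ := (1/(1+σΔt))·u*·(I − e₁e₁ᵀ) + û₀ e₁ᵀ. Then the scheme is energy stable: (1/2)‖u¹‖_F² + (1/2)‖B¹‖² ≤ (1/2)‖u⁰‖_F² + (1/2)‖B⁰‖². -/
open Matrix Finset

/-- Squared Frobenius norm. -/
def frobSq {m n : ℕ} (M : Matrix (Fin m) (Fin n) ℝ) : ℝ := ∑ j, ∑ k, (M j k) ^ 2

lemma frobSq_eq_trace {m n : ℕ} (M : Matrix (Fin m) (Fin n) ℝ) :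
    frobSq M = Matrix.trace (Mᵀ * M) := by
  unfold frobSq
  rw [Finset.sum_comm]
  simp [Matrix.trace, Matrix.mul_apply, sq]

lemma frobSq_nonneg {m n : ℕ} (M : Matrix (Fin m) (Fin n) ℝ) : 0 ≤ frobSq M := by
  unfold frobSq; positivity

lemma frobSq_transpose {m n : ℕ} (M : Matrix (Fin m) (Fin n) ℝ) : frobSq Mᵀ = frobSq M := by
  unfold frobSq
  rw [Finset.sum_comm]; rfl

lemma frobSq_proj_left {m n : ℕ} (P : Matrix (Fin m) (Fin m) ℝ) (hs : Pᵀ = P) (hi : P * P = P)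
    (M : Matrix (Fin m) (Fin n) ℝ) : frobSq (P * M) ≤ frobSq M := by
  have h := frobSq_nonneg (M - P * M)
  have e : (M - P * M)ᵀ * (M - P * M) = Mᵀ * M - (P * M)ᵀ * (P * M) := by
    have h1 : (P * M)ᵀ * (P * M) = Mᵀ * (P * M) := by
      rw [Matrix.transpose_mul, hs, Matrix.mul_assoc, ← Matrix.mul_assoc P P M, hi]
    have h2 : (P * M)ᵀ * M = Mᵀ * (P * M) := by
      rw [Matrix.transpose_mul, hs, Matrix.mul_assoc]
    rw [Matrix.transpose_sub, Matrix.sub_mul, Matrix.mul_sub, Matrix.mul_sub, h1, h2]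
    abel
  rw [frobSq_eq_trace, e, Matrix.trace_sub, ← frobSq_eq_trace, ← frobSq_eq_trace] at h
  linarith

lemma frobSq_proj_right {m n : ℕ} (P : Matrix (Fin n) (Fin n) ℝ) (hs : Pᵀ = P) (hi : P * P = P)
    (M : Matrix (Fin m) (Fin n) ℝ) : frobSq (M * P) ≤ frobSq M := by
  rw [← frobSq_transpose (M * P), ← frobSq_transpose M, Matrix.transpose_mul, hs]
  exact frobSq_proj_left P hs hi _

lemma frobSq_orth {m n : ℕ} (Q : Matrix (Fin n) (Fin n) ℝ) (hQ : Q * Qᵀ = 1)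
    (M : Matrix (Fin m) (Fin n) ℝ) : frobSq (M * Q) = frobSq M := by
  rw [frobSq_eq_trace, frobSq_eq_trace, Matrix.trace_mul_comm, Matrix.transpose_mul,
    Matrix.mul_assoc, ← Matrix.mul_assoc Q, hQ, Matrix.one_mul, Matrix.trace_mul_comm]

lemma Dx_apply (nx : ℕ) [NeZero nx] (hnx : 3 ≤ nx) (dx : ℝ) {N : ℕ}
    (w : Matrix (Fin nx) (Fin N) ℝ) (p : Fin nx) (k : Fin N) :
    (Dx nx dx * w) p k = 1 / (2 * dx) * (w (p + 1) k - w (p - 1) k) := by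
  obtain ⟨-, -, h⟩ := fin_facts nx hnx p
  rw [Matrix.mul_apply]
  have : ∀ q, Dx nx dx p q * w q k = (if q = p + 1 then 1 / (2 * dx) * w q k else 0)
      + (if q = p - 1 then -(1 / (2 * dx)) * w q k else 0) := by
    intro q
    simp only [Dx, Matrix.of_apply]
    by_cases h1 : q = p + 1
    · subst h1; simp [h]
    · simp [h1]
  simp only [this, Finset.sum_add_distrib, Finset.sum_ite_eq', Finset.mem_univ, if_true]
  ring

lemma Dxx_apply (nx : ℕ) [NeZero nx] (hnx : 3 ≤ nx) (dx : ℝ) {N : ℕ}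
    (w : Matrix (Fin nx) (Fin N) ℝ) (p : Fin nx) (k : Fin N) :
    (Dxx nx dx * w) p k = -(1 / dx) * w p k + 1 / (2 * dx) * (w (p + 1) k + w (p - 1) k) := by
  obtain ⟨ha, hb, h⟩ := fin_facts nx hnx p
  rw [Matrix.mul_apply]
  have : ∀ q, Dxx nx dx p q * w q k = (if q = p then -(1 / dx) * w q k else 0)
      + ((if q = p + 1 then 1 / (2 * dx) * w q k else 0)
      + (if q = p - 1 then (1 / (2 * dx)) * w q k else 0)) := by
    intro q
    simp only [Dxx, Matrix.of_apply]
    by_cases h0 : q = p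
    · subst h0; simp [ha.symm, hb.symm]
    · by_cases h1 : q = p + 1
      · subst h1; simp [h, ha]
      · simp [h1, h0]
  simp only [this, Finset.sum_add_distrib, Finset.sum_ite_eq', Finset.mem_univ, if_true]
  ring

lemma convex_sq (a b c x y z : ℝ) (ha : 0 ≤ a) (hb : 0 ≤ b) (hc : 0 ≤ c) (h : a + b + c = 1) :
    (a * x + b * y + c * z) ^ 2 ≤ a * x ^ 2 + b * y ^ 2 + c * z ^ 2 := by
  obtain rfl : a = 1 - b - c := by linarith
  nlinarith [mul_nonneg (mul_nonneg ha hb) (sq_nonneg (x - y)),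
    mul_nonneg (mul_nonneg ha hc) (sq_nonneg (x - z)),
    mul_nonneg (mul_nonneg hb hc) (sq_nonneg (y - z))]

lemma upwind_stable (nx N : ℕ) [NeZero nx] (hnx : 3 ≤ nx) (dx dt : ℝ) (hdx : 0 < dx)
    (hdt : 0 < dt) (hdtdx : dt ≤ dx) (s : Fin N → ℝ) (hs : ∀ k, |s k| ≤ 1)
    (w : Matrix (Fin nx) (Fin N) ℝ) :
    frobSq (w - dt • (Dx nx dx * w * Matrix.diagonal s)
      + dt • (Dxx nx dx * w * Matrix.diagonal (fun i => |s i|))) ≤ frobSq w := by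
  unfold frobSq
  rw [Finset.sum_comm, Finset.sum_comm (f := fun j k => (w j k) ^ 2)]
  refine Finset.sum_le_sum fun k _ => ?_
  set t := |s k| with ht
  have hr : 0 ≤ dt / dx := by positivity
  have hr1 : dt / dx ≤ 1 := by rw [div_le_one hdx]; exact hdtdx
  have hta : 0 ≤ t - s k := sub_nonneg.2 (le_abs_self _)
  have htb : 0 ≤ t + s k := by have := neg_abs_le (s k); linarith
  have ht0 : 0 ≤ t := abs_nonneg _
  set r := dt / dx with hrdef
  have key : ∀ p, ((w - dt • (Dx nx dx * w * Matrix.diagonal s)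
      + dt • (Dxx nx dx * w * Matrix.diagonal (fun i => |s i|))) p k) ^ 2
      ≤ (1 - r * t) * w p k ^ 2 + (r * (t - s k) / 2) * w (p + 1) k ^ 2
        + (r * (t + s k) / 2) * w (p - 1) k ^ 2 := by
    intro p
    have := convex_sq (1 - r * t) (r * (t - s k) / 2) (r * (t + s k) / 2)
      (w p k) (w (p + 1) k) (w (p - 1) k)
      (by have := mul_le_one₀ hr1 ht0 (hs k); linarith) (by positivity) (by positivity) (by ring)
    refine le_of_eq_of_le ?_ this
    congr 1
    simp only [Matrix.add_apply, Matrix.sub_apply, Matrix.smul_apply, Matrix.mul_diagonal,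
      Dx_apply nx hnx, Dxx_apply nx hnx, smul_eq_mul, ← ht, hrdef]
    field_simp
    ring
  refine (Finset.sum_le_sum fun p _ => key p).trans (le_of_eq ?_)
  have e1 : ∑ p, w (p + 1) k ^ 2 = ∑ p, w p k ^ 2 :=
    Equiv.sum_comp (Equiv.addRight (1 : Fin nx)) (fun p => w p k ^ 2)
  have e2 : ∑ p, w (p - 1) k ^ 2 = ∑ p, w p k ^ 2 :=
    Equiv.sum_comp (Equiv.subRight (1 : Fin nx)) (fun p => w p k ^ 2)
  simp only [Finset.sum_add_distrib, ← Finset.mul_sum, e1, e2]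
  ring

lemma implicit_energy {n : ℕ} (P : Matrix (Fin n) (Fin n) ℝ) (hs : Pᵀ = P)
    (s : ℝ) (h0 : 0 ≤ s) (y a b c : Fin n → ℝ) (ha : a = y + s • (b - a))
    (hb : b = c + s • (a - b)) (hP : P.mulVec a = a) :
    ∑ j, a j ^ 2 + ∑ j, b j ^ 2 ≤ ∑ j, (P.mulVec y) j ^ 2 + ∑ j, c j ^ 2 := by
  have hy : ∑ j, a j * y j = ∑ j, a j * (P.mulVec y) j := by
    change a ⬝ᵥ y = a ⬝ᵥ P.mulVec y
    rw [Matrix.dotProduct_mulVec, ← Matrix.mulVec_transpose, hs, hP]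
  have e : ∑ j, (a j * y j + b j * c j)
      = ∑ j, (a j ^ 2 + b j ^ 2 + s * (a j - b j) ^ 2) := by
    refine Finset.sum_congr rfl fun j _ => ?_
    have h1 := congrFun ha j
    have h2 := congrFun hb j
    simp only [Pi.add_apply, Pi.smul_apply, Pi.sub_apply, smul_eq_mul] at h1 h2
    linear_combination (-a j) * h1 - b j * h2
  rw [Finset.sum_add_distrib, hy, ← Finset.sum_add_distrib] at e
  have i1 : ∑ j, (a j ^ 2 + b j ^ 2) ≤ ∑ j, (a j * (P.mulVec y) j + b j * c j) := by
    rw [e]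
    refine Finset.sum_le_sum fun j _ => ?_
    have := mul_nonneg h0 (sq_nonneg (a j - b j)); linarith
  have i2 : ∑ j, (a j * (P.mulVec y) j + b j * c j) ≤
      ∑ j, (1 / 2 * (a j ^ 2 + b j ^ 2) + 1 / 2 * ((P.mulVec y) j ^ 2 + c j ^ 2)) := by
    refine Finset.sum_le_sum fun j _ => ?_
    nlinarith [sq_nonneg (a j - (P.mulVec y) j), sq_nonneg (b j - c j)]
  have i3 := i1.trans i2
  simp only [Finset.sum_add_distrib, ← Finset.mul_sum] at i3
  linarith

/-- Theorem 3 of the paper: energy stability of the fully discrete coupled-implicit DLRA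
scheme under the CFL condition `Δt ≤ Δx`. With `u* = u⁰ − Δt P^X D^x u⁰ A P^V
+ Δt P^X D^xx u⁰ |A| P^V`, the implicitly coupled zeroth moment `û₀` and internal energy
`B¹`, and `u¹ = (1/(1+σΔt)) u* (I − e₁e₁ᵀ) + û₀ e₁ᵀ`, one has
`½‖u¹‖_F² + ½‖B¹‖² ≤ ½‖u⁰‖_F² + ½‖B⁰‖²`. -/
theorem fully_discrete_energy_stability (nx N : ℕ) [NeZero nx] [NeZero N] (hnx : 3 ≤ nx)
    (dx dt σ : ℝ) (hdx : 0 < dx) (hdt : 0 < dt) (hdtdx : dt ≤ dx) (hσ : 0 ≤ σ)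
    (Q : Matrix (Fin N) (Fin N) ℝ) (hQ : Qᵀ * Q = 1) (hQ' : Q * Qᵀ = 1)
    (σs : Fin N → ℝ) (hσs : ∀ k, |σs k| ≤ 1)
    (PX : Matrix (Fin nx) (Fin nx) ℝ) (hPXsymm : PXᵀ = PX) (hPXidem : PX * PX = PX)
    (PV : Matrix (Fin N) (Fin N) ℝ) (hPVsymm : PVᵀ = PV) (hPVidem : PV * PV = PV)
    (hPVe1 : PV.mulVec (e1 N) = e1 N)
    (u0 : Matrix (Fin nx) (Fin N) ℝ) (hu0PX : PX * u0 = u0) (hu0PV : u0 * PV = u0)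
    (B0 hatu0 B1 : Fin nx → ℝ)
    (hhatu0 : hatu0 = u0.mulVec (e1 N)
        - dt • (Dx nx dx * u0 * (Q * Matrix.diagonal σs * Qᵀ)).mulVec (e1 N)
        + dt • (Dxx nx dx * u0 * (Q * Matrix.diagonal (fun i => |σs i|) * Qᵀ)).mulVec (e1 N)
        + (σ * dt) • (B1 - hatu0))
    (hB1 : B1 = B0 + (σ * dt) • (hatu0 - B1))
    (hhatu0PX : PX.mulVec hatu0 = hatu0)
    (u1 : Matrix (Fin nx) (Fin N) ℝ)
    (hu1 : u1 = (1 / (1 + σ * dt)) •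
        ((u0 - dt • (PX * Dx nx dx * u0 * (Q * Matrix.diagonal σs * Qᵀ) * PV)
            + dt • (PX * Dxx nx dx * u0 * (Q * Matrix.diagonal (fun i => |σs i|) * Qᵀ) * PV)) *
          (1 - Matrix.vecMulVec (e1 N) (e1 N)))
        + Matrix.vecMulVec hatu0 (e1 N)) :
    (1 / 2) * ∑ j, ∑ m, (u1 j m) ^ 2 + (1 / 2) * ∑ j, (B1 j) ^ 2 ≤
      (1 / 2) * ∑ j, ∑ m, (u0 j m) ^ 2 + (1 / 2) * ∑ j, (B0 j) ^ 2 := by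
  set A := Q * Matrix.diagonal σs * Qᵀ with hA
  set Aa := Q * Matrix.diagonal (fun i => |σs i|) * Qᵀ with hAa
  set L := u0 - dt • (Dx nx dx * u0 * A) + dt • (Dxx nx dx * u0 * Aa) with hL
  have hLnorm : frobSq L ≤ frobSq u0 := by
    have h := upwind_stable nx N hnx dx dt hdx hdt hdtdx σs hσs (u0 * Q)
    rw [frobSq_orth Q hQ'] at h
    rw [← frobSq_orth Q hQ' L]
    convert h using 2
    have hAQ : A * Q = Q * Matrix.diagonal σs := by
      rw [hA, Matrix.mul_assoc, hQ, Matrix.mul_one]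
    have hAaQ : Aa * Q = Q * Matrix.diagonal (fun i => |σs i|) := by
      rw [hAa, Matrix.mul_assoc, hQ, Matrix.mul_one]
    rw [hL, Matrix.add_mul, Matrix.sub_mul, Matrix.smul_mul, Matrix.smul_mul,
      Matrix.mul_assoc _ A Q, Matrix.mul_assoc _ Aa Q, hAQ, hAaQ]
    simp only [Matrix.mul_assoc]
  have hus : u0 - dt • (PX * Dx nx dx * u0 * A * PV) + dt • (PX * Dxx nx dx * u0 * Aa * PV)
      = PX * L * PV := by
    have h0 : PX * u0 * PV = u0 := by rw [hu0PX, hu0PV]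
    rw [hL, Matrix.mul_add, Matrix.mul_sub, Matrix.add_mul, Matrix.sub_mul, h0]
    simp only [Matrix.mul_smul, Matrix.smul_mul, Matrix.mul_assoc]
  rw [hus] at hu1
  set us := PX * L * PV with husdef
  have husnorm : frobSq us ≤ frobSq u0 :=
    (frobSq_proj_right PV hPVsymm hPVidem _).trans
      ((frobSq_proj_left PX hPXsymm hPXidem _).trans hLnorm)
  have hus0 : ∀ M : Matrix (Fin nx) (Fin N) ℝ, ∀ j, M.mulVec (e1 N) j = M j 0 := by
    intro M j
    simp [Matrix.mulVec, dotProduct, e1]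
  have hy : PX.mulVec (L.mulVec (e1 N)) = us.mulVec (e1 N) := by
    rw [husdef, ← Matrix.mulVec_mulVec, hPVe1, Matrix.mulVec_mulVec]
  have hs0 : 0 ≤ σ * dt := by positivity
  have hE := implicit_energy PX hPXsymm (σ * dt) hs0 (L.mulVec (e1 N)) hatu0 B1 B0
    (by
      rw [hL, Matrix.add_mulVec, Matrix.sub_mulVec, Matrix.smul_mulVec, Matrix.smul_mulVec]
      exact hhatu0) hB1 hhatu0PX
  rw [hy] at hE
  simp only [hus0] at hE
  set c := 1 / (1 + σ * dt) with hc
  have hc0 : 0 ≤ c := by positivity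
  have hc1 : c ≤ 1 := by rw [hc, div_le_one (by positivity)]; linarith
  have hc2 : c ^ 2 ≤ 1 := pow_le_one₀ hc0 hc1
  have hent : ∀ j m, u1 j m = if m = 0 then hatu0 j else c * us j m := by
    intro j m
    rw [hu1, Matrix.mul_sub, Matrix.mul_one, Matrix.mul_vecMulVec]
    simp only [Matrix.add_apply, Matrix.smul_apply, Matrix.sub_apply, Matrix.vecMulVec_apply,
      hus0, smul_eq_mul]
    by_cases hm : m = 0
    · subst hm; simp [e1]
    · simp [e1, hm]
  have hrow : ∀ j, ∑ m, (u1 j m) ^ 2 ≤ hatu0 j ^ 2 - us j 0 ^ 2 + ∑ m, us j m ^ 2 := by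
    intro j
    rw [← Finset.add_sum_erase _ _ (Finset.mem_univ (0 : Fin N)),
      ← Finset.add_sum_erase _ (fun m => us j m ^ 2) (Finset.mem_univ (0 : Fin N))]
    have h1 : ∑ m ∈ Finset.univ.erase (0 : Fin N), (u1 j m) ^ 2
        ≤ ∑ m ∈ Finset.univ.erase (0 : Fin N), us j m ^ 2 := by
      refine Finset.sum_le_sum fun m hm => ?_
      rw [hent, if_neg (Finset.ne_of_mem_erase hm), mul_pow]
      exact mul_le_of_le_one_left (sq_nonneg _) hc2
    have h2 : u1 j 0 = hatu0 j := by rw [hent]; simp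
    rw [h2]
    linarith
  have htot := Finset.sum_le_sum fun j (_ : j ∈ Finset.univ) => hrow j
  rw [Finset.sum_add_distrib, Finset.sum_sub_distrib] at htot
  unfold frobSq at husnorm
  linarith
end
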